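/- Lower bound on the Price of Fairness of any fair rule for a bad: fix n ≥ 2 and consider the normalized problem with two equally likely states ω, ω′ and disutility profiles x = (4/(n+1), 2, 2, …, 2) in ω and x′ = (2(n−1)/(n+1), 0, 0, …, 0) in ω′. Then for every pair of allocations ψ, ψ′ ∈ Δ(N) satisfying Fair Share — i.e., (1/2)(ψ_i·x_i + ψ′_i·x′_i) ≤ 1/n for every agent i — the expected total cost satisfies (1/2)(∑_i ψ_i·x_i + ∑_i ψ′_i·x′_i) ≥ (n+1)/(2n). Since E[min_i X_i] = 2/(n+1) in this problem, every allocation satisfying Fair Share incurs expected cost at least ((n+1)²/(4n))·E[min_i X_i] = (n/4 + 1/2 + 1/(4n))·E[min_i X_i]. -/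

import Mathlib

noncomputable section

namespace PaperFD16

/-- Disutility profile in state `ω` of the two-state problem:
`x = (4/(n+1), 2, …, 2)`. -/
def xOmega (n : ℕ) (i : Fin n) : ℝ :=
  if (i : ℕ) = 0 then 4 / ((n : ℝ) + 1) else 2

/-- Disutility profile in state `ω′`: `x′ = (2(n−1)/(n+1), 0, …, 0)`. -/
def xOmega' (n : ℕ) (i : Fin n) : ℝ :=
  if (i : ℕ) = 0 then 2 * ((n : ℝ) - 1) / ((n : ℝ) + 1) else 0

/-- Step 1 of Proposition 5 (iii), lower bound on the Price of Fairness for a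
bad: in the normalized two-state problem with profiles `x` in `ω` and `x′` in
`ω′` (each with probability `1/2`), every pair of allocations `ψ, ψ′ ∈ Δ(N)`
satisfying Fair Share incurs expected total cost at least `(n+1)/(2n)`; since
`E[min_i X_i] = 2/(n+1)`, this cost is `(n/4 + 1/2 + 1/(4n)) · E[min_i X_i]`. -/
theorem price_of_fairness_lower_bound_bad
    (n : ℕ) (hn : 2 ≤ n)
    (ψ ψ' : Fin n → ℝ)
    (hψ : (∀ i, 0 ≤ ψ i) ∧ ∑ i, ψ i = 1)
    (hψ' : (∀ i, 0 ≤ ψ' i) ∧ ∑ i, ψ' i = 1)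
    (hfs : ∀ i, (1 / 2 : ℝ) * (ψ i * xOmega n i + ψ' i * xOmega' n i) ≤ 1 / (n : ℝ)) :
    ((n : ℝ) + 1) / (2 * n)
        ≤ (1 / 2 : ℝ) * (∑ i, ψ i * xOmega n i + ∑ i, ψ' i * xOmega' n i) ∧
    ((n : ℝ) + 1) / (2 * n)
        = ((n : ℝ) / 4 + 1 / 2 + 1 / (4 * n)) * (2 / ((n : ℝ) + 1)) := by
  obtain ⟨m, rfl⟩ : ∃ m, n = m + 1 := ⟨n - 1, by omega⟩
  obtain ⟨-, hsum⟩ := hψ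
  have hb := hψ'.1 0
  have hfair := hfs 0
  simp only [Fin.sum_univ_succ, xOmega, xOmega', Fin.val_zero, Fin.val_succ, if_true,
    Nat.succ_ne_zero, if_false, mul_zero, Finset.sum_const_zero, add_zero,
    ← Finset.sum_mul] at hsum hfair ⊢
  rw [← eq_sub_iff_add_eq'] at hsum
  rw [hsum]
  push_cast at hfair ⊢
  generalize ψ 0 = a at hfair ⊢
  generalize ψ' 0 = b at hb hfair ⊢
  constructor
  · have hb' : 0 ≤ b * (2 * ((m : ℝ) + 1 - 1) / (m + 1 + 1)) := by
      rw [add_sub_cancel_right]; positivity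
    -- Fair Share for agent `0` bounds its share of the bad in state `ω`.
    have ha : 2 * (m + 1) * a ≤ m + 2 := by
      have h : 1 / 2 * (a * (4 / ((m : ℝ) + 1 + 1))) ≤ 1 / (m + 1) := by linarith
      field_simp at h
      linarith
    have hcost : ((m : ℝ) + 1 + 1) / (2 * (m + 1)) ≤
        1 / 2 * (a * (4 / (m + 1 + 1)) + (1 - a) * 2) := by
      rw [← sub_nonneg]
      have h : 1 / 2 * (a * (4 / ((m : ℝ) + 1 + 1)) + (1 - a) * 2)
          - ((m : ℝ) + 1 + 1) / (2 * (m + 1))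
          = m * (m + 2 - 2 * (m + 1) * a) / (2 * (m + 1) * (m + 2)) := by
        field_simp
        ring
      rw [h]
      have := sub_nonneg.2 ha
      positivity
    linarith
  · field_simp
    ring

end PaperFD16
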